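/- Let A be a Noetherian reduced commutative ring and let J ⊆ A be an ideal containing a non-zerodivisor a of A. Then the natural map A → Hom_A(J, J), sending x ∈ A to multiplication by x, is surjective if and only if aJ : J = ⟨a⟩_A, where aJ : J := {b ∈ A : bJ ⊆ aJ} and ⟨a⟩_A is the principal ideal generated by a. -/

import Mathlib

/-- Multiplication by `b` followed by division by a non-zerodivisor `a`, as an endomorphism of
an ideal `J` with `bJ ⊆ aJ`. -/
theorem Ideal.exists_end_mul_eq_mul_of_mem_colon {A : Type*} [CommRing A] {J : Ideal A} {a b : A}
    (ha : a ∈ nonZeroDivisors A) (hb : b ∈ (Ideal.span {a} * J).colon (J : Set A)) :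
    ∃ f : Module.End A J, ∀ j : J, a * (f j : A) = b * j := by
  have h : ∀ j : J, ∃ k : J, a * (k : A) = b * j := fun j ↦ by
    obtain ⟨k, hk, hkj⟩ :=
      Ideal.mem_span_singleton_mul.mp (Submodule.mem_colon.mp hb j j.2)
    exact ⟨⟨k, hk⟩, hkj⟩
  choose f hf using h
  refine ⟨{ toFun := f, map_add' := fun x y ↦ ?_, map_smul' := fun r x ↦ ?_ }, hf⟩
  · apply Subtype.ext
    rw [← mul_cancel_left_mem_nonZeroDivisors ha, hf, Submodule.coe_add, Submodule.coe_add,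
      mul_add, mul_add, hf, hf]
  · apply Subtype.ext
    rw [← mul_cancel_left_mem_nonZeroDivisors ha, hf, RingHom.id_apply, Submodule.coe_smul,
      Submodule.coe_smul, smul_eq_mul, smul_eq_mul, mul_left_comm, mul_left_comm a, hf]

/-- An endomorphism of an ideal satisfies `j * f i = i * f j`. -/
theorem Ideal.mul_end_apply_comm {A : Type*} [CommRing A] {J : Ideal A} (f : Module.End A J)
    (i j : J) : (j : A) * (f i : A) = i * (f j : A) := by
  have h : (j : A) • i = (i : A) • j := Subtype.ext (mul_comm _ _)
  simpa using congrArg (fun x ↦ (f x : A)) h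

/-- Let `A` be a Noetherian reduced commutative ring and let `J ⊆ A` be an
ideal containing a non-zerodivisor `a`.  Then the natural map
`A → Hom_A(J, J)` is surjective if and only if `aJ : J = ⟨a⟩`. -/
theorem end_surjective_iff_colon_eq_span
    (A : Type*) [CommRing A] [IsNoetherianRing A] [IsReduced A]
    (J : Ideal A) (a : A) (haJ : a ∈ J) (ha : a ∈ nonZeroDivisors A) :
    Function.Surjective (algebraMap A (Module.End A J)) ↔
      (Ideal.span {a} * J).colon J = Ideal.span {a} := by
  constructor
  · intro hsurj
    apply le_antisymm
    · intro b hb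
      obtain ⟨f, hf⟩ := Ideal.exists_end_mul_eq_mul_of_mem_colon ha hb
      obtain ⟨x, rfl⟩ := hsurj f
      have h : a * (x * a) = b * a := by simpa using hf ⟨a, haJ⟩
      refine Ideal.mem_span_singleton'.mpr ⟨x, ?_⟩
      rwa [mul_comm a, mul_cancel_right_mem_nonZeroDivisors ha] at h
    · rw [Ideal.span_singleton_le_iff_mem, Submodule.mem_colon]
      exact fun j hj ↦ Ideal.mul_mem_mul (Ideal.mem_span_singleton_self a) hj
  · intro hcolon f
    have hmem : (f ⟨a, haJ⟩ : A) ∈ (Ideal.span {a} * J).colon (J : Set A) := by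
      refine Submodule.mem_colon.mpr fun j hj ↦ Ideal.mem_span_singleton_mul.mpr
        ⟨f ⟨j, hj⟩, (f ⟨j, hj⟩).2, ?_⟩
      rw [Ideal.mul_end_apply_comm f ⟨j, hj⟩ ⟨a, haJ⟩, smul_eq_mul, mul_comm]
    rw [hcolon] at hmem
    obtain ⟨x, hx⟩ := Ideal.mem_span_singleton'.mp hmem
    refine ⟨x, LinearMap.ext fun j ↦ Subtype.ext ?_⟩
    have h := Ideal.mul_end_apply_comm f j ⟨a, haJ⟩
    rw [← hx] at h
    rw [← mul_cancel_left_mem_nonZeroDivisors ha, h, Module.algebraMap_end_apply,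
      Submodule.coe_smul, smul_eq_mul]
    ring
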